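/- For every real number x with |x| < pi/2, the series sum over n >= 1 of b(n,1) x^n / n! converges and its sum equals (1/6) * ((3x^2 + 6x - 6) cos x - (6x + 6) sin x + x^3 + 3x^2 + 6)/(1 - sin x). -/

import Mathlib

namespace BalancedTrees

/-- Plane binary trees with vertices labeled by natural numbers;
`nil` is the empty tree, and each child of a vertex is designated
as a left child or a right child. -/
inductive BT where
  | nil : BT
  | node (label : ℕ) (l r : BT) : BT
deriving DecidableEq

namespace BT

/-- `balRank t = some k` if and only if the root of `t` is a balanced vertex of
rank `k`, i.e. every descending path from the root to a leaf has length `k`. -/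
def balRank : BT → Option ℕ
  | .nil => none
  | .node _ .nil .nil => some 0
  | .node _ .nil (.node b rl rr) => (balRank (BT.node b rl rr)).map (· + 1)
  | .node _ (.node a ll lr) .nil => (balRank (BT.node a ll lr)).map (· + 1)
  | .node _ (.node a ll lr) (.node b rl rr) =>
      match balRank (BT.node a ll lr), balRank (BT.node b rl rr) with
      | some i, some j => if i = j then some (i + 1) else none
      | _, _ => none

/-- The number of balanced vertices of rank `k` in the tree `t`. -/
def countBal (k : ℕ) : BT → ℕ
  | .nil => 0
  | .node v l r =>
      countBal k l + countBal k r +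
        (if balRank (BT.node v l r) = some k then 1 else 0)

/-- The number of balanced vertices (of any rank) in the tree `t`. -/
def countBalAll : BT → ℕ
  | .nil => 0
  | .node v l r =>
      countBalAll l + countBalAll r +
        (if (balRank (BT.node v l r)).isSome then 1 else 0)

/-- Auxiliary, fuelled version of `treeOf`. -/
def treeOfAux : ℕ → List ℕ → BT
  | 0, _ => .nil
  | _ + 1, [] => .nil
  | fuel + 1, l =>
      let m := l.foldr max 0
      BT.node m (treeOfAux fuel (l.takeWhile (· != m)))
                (treeOfAux fuel ((l.dropWhile (· != m)).tail))

/-- The decreasing binary tree `T(π)` of a sequence `π` of distinct labels: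
the root is the maximum entry, and its left (resp. right) subtree is built
recursively from the part of the sequence to the left (resp. right) of the
maximum. This is a bijection between permutations of `{1,…,n}` and
decreasing binary trees on `{1,…,n}`. -/
def treeOf (l : List ℕ) : BT := treeOfAux l.length l

/-- Canonical form for non-plane 1-2 trees (as represented by plane trees):
an only child is stored as a left child, and of two (unordered) children the
one with the larger label is stored on the left. Decreasing binary trees in
canonical form are in bijection with non-plane 1-2 trees. -/
def canonNP : BT → Bool
  | .nil => true
  | .node _ l r =>
      canonNP l && canonNP r &&
        (match l, r with
         | .nil, .nil => true
         | .node _ _ _, .nil => true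
         | .nil, .node _ _ _ => false
         | .node a _ _, .node b _ _ => decide (b < a))

/-- Canonical form for plane 1-2 trees: an only child is stored as a left
child (an only child carries no left/right designation), while two children
remain ordered. Decreasing binary trees in canonical form are in bijection
with plane 1-2 trees. -/
def canonP : BT → Bool
  | .nil => true
  | .node _ l r =>
      canonP l && canonP r &&
        (match l, r with
         | .nil, .node _ _ _ => false
         | _, _ => true)

end BT

open BT

/-- The list of all permutations of `{1,…,n}`, each written as a list. -/
def perms (n : ℕ) : List (List ℕ) := (List.range' 1 n).permutations

/-- `a n k`: the total number of balanced vertices of rank `k` over all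
decreasing binary trees on `{1,…,n}`. -/
def a (n k : ℕ) : ℕ := ((perms n).map fun l => countBal k (treeOf l)).sum

/-- `r n k`: the number of decreasing binary trees on `{1,…,n}` whose root is
balanced of rank `k`. -/
def r (n k : ℕ) : ℕ :=
  ((perms n).filter fun l => decide (balRank (treeOf l) = some k)).length

/-- `p n k`: the probability that the root of a uniformly random decreasing
binary tree on `{1,…,n}` is balanced of rank `k`; by convention `p 0 k = 1`. -/
def p (n k : ℕ) : ℚ := if n = 0 then 1 else (r n k : ℚ) / (Nat.factorial n : ℚ)

/-- The number of decreasing binary trees on `{1,…,n}` whose root is balanced. -/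
def rootBal (n : ℕ) : ℕ :=
  ((perms n).filter fun l => (balRank (treeOf l)).isSome).length

/-- `proot n`: the probability that the root of a uniformly random decreasing
binary tree on `{1,…,n}` is balanced. -/
def proot (n : ℕ) : ℚ := (rootBal n : ℚ) / (Nat.factorial n : ℚ)

/-- The total number of balanced vertices over all decreasing binary trees
on `{1,…,n}`. -/
def totalBal (n : ℕ) : ℕ := ((perms n).map fun l => countBalAll (treeOf l)).sum

/-- `Pbal n`: the probability that a vertex chosen uniformly at random from
the `n * n!` vertices of all decreasing binary trees on `{1,…,n}` is balanced. -/
def Pbal (n : ℕ) : ℚ := (totalBal n : ℚ) / ((n : ℚ) * (Nat.factorial n : ℚ))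

/-- Permutations whose decreasing binary tree is a canonical representative
of a non-plane 1-2 tree; these are in bijection with non-plane 1-2 trees
on `{1,…,n}`. -/
def npPerms (n : ℕ) : List (List ℕ) := (perms n).filter fun l => canonNP (treeOf l)

/-- `E n`: the number of non-plane 1-2 trees on `{1,…,n}` (the Euler number). -/
def E (n : ℕ) : ℕ := (npPerms n).length

/-- `b n k`: the total number of balanced vertices of rank `k` over all
non-plane 1-2 trees on `{1,…,n}`. -/
def b (n k : ℕ) : ℕ := ((npPerms n).map fun l => countBal k (treeOf l)).sum

/-- `s n k`: the number of non-plane 1-2 trees on `{1,…,n}` whose root is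
balanced of rank `k`. -/
def s (n k : ℕ) : ℕ :=
  ((npPerms n).filter fun l => decide (balRank (treeOf l) = some k)).length

/-- Permutations whose decreasing binary tree is a canonical representative
of a plane 1-2 tree; these are in bijection with plane 1-2 trees on `{1,…,n}`. -/
def pPerms (n : ℕ) : List (List ℕ) := (perms n).filter fun l => canonP (treeOf l)

/-- `z n`: the number of plane 1-2 trees on `{1,…,n}`. -/
def z (n : ℕ) : ℕ := (pPerms n).length

/-- `d n k`: the total number of balanced vertices of rank `k` over all
plane 1-2 trees on `{1,…,n}`. -/
def d (n k : ℕ) : ℕ := ((pPerms n).map fun l => countBal k (treeOf l)).sum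

/-- `t n k`: the number of plane 1-2 trees on `{1,…,n}` whose root is
balanced of rank `k`. -/
def t (n k : ℕ) : ℕ :=
  ((pPerms n).filter fun l => decide (balRank (treeOf l) = some k)).length

end BalancedTrees

namespace BalancedTrees

namespace BT

theorem foldr_max_append_cons {m : ℕ} {l₁ l₂ : List ℕ} (h₁ : ∀ a ∈ l₁, a < m)
    (h₂ : ∀ a ∈ l₂, a < m) : (l₁ ++ m :: l₂).foldr max 0 = m := by
  have le_of_lt : ∀ l : List ℕ, (∀ a ∈ l, a < m) → l.foldr max 0 ≤ m := by
    intro l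
    induction l with
    | nil => simp
    | cons c l ih =>
      intro h
      simp only [List.mem_cons, forall_eq_or_imp] at h
      simpa using ⟨h.1.le, ih h.2⟩
  induction l₁ with
  | nil => simpa using le_of_lt l₂ h₂
  | cons c l ih =>
    simp only [List.mem_cons, forall_eq_or_imp] at h₁
    simpa [ih h₁.2] using h₁.1.le

theorem foldr_max_mem {l : List ℕ} (hl : l ≠ []) : l.foldr max 0 ∈ l := by
  induction l with
  | nil => simp at hl
  | cons c l ih =>
    rcases eq_or_ne l [] with rfl | h
    · simp
    · rcases max_choice c (l.foldr max 0) with h' | h' <;> simp [h', ih h]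

theorem treeOfAux_congr_fuel {f g : ℕ} {l : List ℕ} (hf : l.length ≤ f) (hg : l.length ≤ g) :
    treeOfAux f l = treeOfAux g l := by
  induction f generalizing g l with
  | zero =>
    obtain rfl : l = [] := by simpa using hf
    cases g <;> rfl
  | succ f ih =>
    cases l with
    | nil => cases g <;> rfl
    | cons c l =>
      cases g with
      | zero => simp at hg
      | succ g =>
        simp only [treeOfAux]
        obtain ⟨l₁, l₂, h, hl₁⟩ := List.eq_append_cons_of_mem (foldr_max_mem (List.cons_ne_nil c l))
        set m := (c :: l).foldr max 0
        have hlen := congrArg List.length h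
        simp only [List.length_append, List.length_cons] at hlen hf hg
        have hp : ∀ a ∈ l₁, (a != m) = true := by
          intro a ha
          simpa using fun e : a = m => hl₁ (e ▸ ha)
        rw [h, List.takeWhile_append_of_pos hp, List.dropWhile_append_of_pos hp]
        simp only [bne_self_eq_false, Bool.false_eq_true, not_false_eq_true,
          List.takeWhile_cons_of_neg, List.append_nil, List.dropWhile_cons_of_neg, List.tail_cons]
        rw [ih (l := l₁) (g := g) (by omega) (by omega),
          ih (l := l₂) (g := g) (by omega) (by omega)]

theorem treeOf_append_cons {m : ℕ} {l₁ l₂ : List ℕ} (h₁ : ∀ a ∈ l₁, a < m)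
    (h₂ : ∀ a ∈ l₂, a < m) :
    treeOf (l₁ ++ m :: l₂) = node m (treeOf l₁) (treeOf l₂) := by
  have hp : ∀ a ∈ l₁, (a != m) = true := fun a ha => by simpa using (h₁ a ha).ne
  have hlen : (l₁ ++ m :: l₂).length = (l₁.length + l₂.length) + 1 := by simp; omega
  have hmax := foldr_max_append_cons h₁ h₂
  unfold treeOf
  rw [hlen, treeOfAux]
  · simp only [hmax, List.takeWhile_append_of_pos hp, List.dropWhile_append_of_pos hp]
    simp only [bne_self_eq_false, Bool.false_eq_true, not_false_eq_true,
      List.takeWhile_cons_of_neg, List.append_nil, List.dropWhile_cons_of_neg, List.tail_cons]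
    rw [treeOfAux_congr_fuel (l := l₁) (g := l₁.length) (by omega) le_rfl,
      treeOfAux_congr_fuel (l := l₂) (g := l₂.length) (by omega) le_rfl]
  · simp

@[simp] theorem treeOf_nil : treeOf [] = nil := rfl

/-- The condition on the subtrees of a vertex of a canonical tree. -/
def ChildrenOrdered : BT → BT → Prop
  | nil, nil => True
  | node _ _ _, nil => True
  | nil, node _ _ _ => False
  | node a _ _, node b _ _ => b < a

theorem canonNP_node (v : ℕ) (l r : BT) :
    canonNP (node v l r) = true ↔ canonNP l = true ∧ canonNP r = true ∧ ChildrenOrdered l r := by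
  cases l <;> cases r <;> simp [canonNP, ChildrenOrdered, and_assoc]

/-- The indicator of canonical trees. -/
def treeWeight (t : BT) : ℕ := if canonNP t = true then 1 else 0

/-- The number of balanced vertices of rank `1`, restricted to canonical trees. -/
def balWeight (t : BT) : ℕ := if canonNP t = true then countBal 1 t else 0

/-- The indicator of trees with at most one vertex. -/
def smallWeight : BT → ℕ
  | nil => 1
  | node _ nil nil => 1
  | _ => 0

open Classical in
theorem treeWeight_node (v : ℕ) (l r : BT) :
    treeWeight (node v l r) =
      if ChildrenOrdered l r then treeWeight l * treeWeight r else 0 := by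
  simp only [treeWeight, canonNP_node]
  split_ifs <;> simp_all

theorem balRank_eq_zero_iff (t : BT) : balRank t = some 0 ↔ ∃ v, t = node v nil nil := by
  rcases t with _ | ⟨v, _ | ⟨a, l₁, l₂⟩, _ | ⟨b, r₁, r₂⟩⟩ <;> simp [balRank]
  split <;> simp

theorem smallWeight_eq (t : BT) :
    smallWeight t = if t = nil ∨ balRank t = some 0 then 1 else 0 := by
  rcases t with _ | ⟨v, _ | ⟨a, l₁, l₂⟩, _ | ⟨b, r₁, r₂⟩⟩ <;>
    simp [balRank_eq_zero_iff, smallWeight]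

theorem canonNP_of_smallWeight {t : BT} (h : smallWeight t ≠ 0) : canonNP t = true := by
  rcases t with _ | ⟨v, _ | ⟨a, l₁, l₂⟩, _ | ⟨b, r₁, r₂⟩⟩ <;>
    simp_all [smallWeight, canonNP]

theorem ite_balRank_eq_one (v : ℕ) {l r : BT} (h : ¬(l = nil ∧ r = nil)) :
    (if balRank (node v l r) = some 1 then 1 else 0) = smallWeight l * smallWeight r := by
  rw [smallWeight_eq, smallWeight_eq]
  rcases l with _ | ⟨a, l₁, l₂⟩ <;> rcases r with _ | ⟨b, r₁, r₂⟩
  · simp at h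
  · simp [balRank]
  · simp [balRank]
  · have key : balRank (node v (node a l₁ l₂) (node b r₁ r₂)) = some 1 ↔
        balRank (node a l₁ l₂) = some 0 ∧ balRank (node b r₁ r₂) = some 0 := by
      rw [balRank]
      rcases balRank (node a l₁ l₂) with _ | i <;> rcases balRank (node b r₁ r₂) with _ | j <;>
        simp
      omega
    simp only [key, reduceCtorEq, false_or]
    split_ifs <;> simp_all

open Classical in
theorem balWeight_node (v : ℕ) {l r : BT} (h : ¬(l = nil ∧ r = nil)) :
    balWeight (node v l r) =
      if ChildrenOrdered l r then
        balWeight l * treeWeight r + treeWeight l * balWeight r + smallWeight l * smallWeight r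
      else 0 := by
  have key := ite_balRank_eq_one v h
  simp only [balWeight, treeWeight, canonNP_node, countBal, key]
  have hl := canonNP_of_smallWeight (t := l)
  have hr := canonNP_of_smallWeight (t := r)
  by_cases h1 : canonNP l = true <;> by_cases h2 : canonNP r = true <;>
    by_cases h3 : ChildrenOrdered l r <;> simp_all

end BT

open BT Finset

/-- The sequences listing every element of `S` exactly once. -/
noncomputable def orderings (S : Finset ℕ) : Finset (List ℕ) := S.toList.permutations.toFinset

theorem mem_orderings {S : Finset ℕ} {l : List ℕ} :
    l ∈ orderings S ↔ l.Nodup ∧ ∀ a, a ∈ l ↔ a ∈ S := by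
  rw [orderings, List.mem_toFinset, List.mem_permutations]
  constructor
  · intro h
    exact ⟨h.nodup_iff.2 S.nodup_toList, fun a => by rw [h.mem_iff, Finset.mem_toList]⟩
  · rintro ⟨h₁, h₂⟩
    rw [List.perm_ext_iff_of_nodup h₁ S.nodup_toList]
    simpa using h₂

@[simp] theorem orderings_empty : orderings ∅ = {[]} := by
  simp [orderings]

/-- The sum of `f` over the decreasing binary trees labeled by `S`. -/
noncomputable def treeSum (f : BT → ℕ) (S : Finset ℕ) : ℕ := ∑ l ∈ orderings S, f (treeOf l)

theorem treeSum_insert (f : BT → ℕ) {S : Finset ℕ} {m : ℕ} (hm : ∀ a ∈ S, a < m) :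
    treeSum f (insert m S) =
      ∑ A ∈ S.powerset, ∑ l₁ ∈ orderings A, ∑ l₂ ∈ orderings (S \ A),
        f (node m (treeOf l₁) (treeOf l₂)) := by
  have hmS : m ∉ S := fun h => (hm m h).false
  simp_rw [← Finset.sum_product' (orderings _) (orderings _)
    (fun l₁ l₂ => f (node m (treeOf l₁) (treeOf l₂)))]
  rw [Finset.sum_sigma', treeSum]
  symm
  refine Finset.sum_bij (fun p _ => p.2.1 ++ m :: p.2.2) ?_ ?_ ?_ ?_
  · rintro ⟨A, l₁, l₂⟩ h
    simp only [mem_sigma, mem_powerset, mem_product, mem_orderings, Finset.mem_sdiff] at h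
    obtain ⟨hA, ⟨n₁, h₁⟩, n₂, h₂⟩ := h
    rw [mem_orderings]
    refine ⟨?_, fun a => ?_⟩
    · rw [List.nodup_append]
      refine ⟨n₁, ?_, ?_⟩
      · rw [List.nodup_cons]
        exact ⟨fun h => hmS ((h₂ m).1 h).1, n₂⟩
      · intro a ha c hc
        rw [List.mem_cons] at hc
        rintro rfl
        rcases hc with rfl | hc
        · exact hmS (hA ((h₁ _).1 ha))
        · exact ((h₂ _).1 hc).2 ((h₁ _).1 ha)
    · simp only [List.mem_append, List.mem_cons, h₁, h₂, Finset.mem_insert]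
      have := @hA a
      tauto
  · rintro ⟨A, l₁, l₂⟩ h ⟨A', l₁', l₂'⟩ h' e
    simp only [mem_sigma, mem_powerset, mem_product, mem_orderings, Finset.mem_sdiff] at h h'
    obtain ⟨hA, ⟨n₁, h₁⟩, n₂, h₂⟩ := h
    obtain ⟨hA', ⟨n₁', h₁'⟩, n₂', h₂'⟩ := h'
    dsimp only at e
    rw [List.append_cons_inj_of_notMem (fun hmem => hmS (hA ((h₁ _).1 hmem)))
      (fun hmem => hmS ((h₂ _).1 hmem).1)] at e
    obtain ⟨rfl, -, rfl⟩ := e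
    obtain rfl : A = A' := by
      ext a
      rw [← h₁, ← h₁']
    rfl
  · intro l hl
    rw [mem_orderings] at hl
    obtain ⟨n, h⟩ := hl
    obtain ⟨l₁, l₂, rfl⟩ := List.append_of_mem ((h m).2 (mem_insert_self m S))
    rw [List.nodup_append, List.nodup_cons] at n
    obtain ⟨n₁, ⟨hm₂, n₂⟩, hd⟩ := n
    simp only [List.mem_append, List.mem_cons, Finset.mem_insert] at h
    refine ⟨⟨l₁.toFinset, l₁, l₂⟩, ?_, rfl⟩
    simp only [mem_sigma, mem_powerset, mem_product, mem_orderings, Finset.mem_sdiff,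
      List.mem_toFinset, implies_true, and_true, n₁, n₂, true_and]
    refine ⟨fun a ha => ?_, fun a => ⟨fun ha => ?_, ?_⟩⟩
    · rw [List.mem_toFinset] at ha
      exact ((h a).1 (Or.inl ha)).resolve_left (hd a ha m (by simp))
    · refine ⟨((h a).1 (Or.inr (Or.inr ha))).resolve_left ?_,
        fun h' => hd a h' a (by simp [ha]) rfl⟩
      rintro rfl
      exact hm₂ ha
    · rintro ⟨haS, ha⟩
      have := (h a).2 (Or.inr haS)
      have : a ≠ m := fun e => hmS (e ▸ haS)
      tauto
  · rintro ⟨A, l₁, l₂⟩ h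
    simp only [mem_sigma, mem_powerset, mem_product, mem_orderings, Finset.mem_sdiff] at h
    obtain ⟨hA, ⟨n₁, h₁⟩, n₂, h₂⟩ := h
    rw [treeOf_append_cons (fun a ha => hm a (hA ((h₁ a).1 ha)))
      (fun a ha => hm a ((h₂ a).1 ha).1)]

theorem exists_treeOf_eq_node {S : Finset ℕ} (hS : S.Nonempty) {l : List ℕ}
    (hl : l ∈ orderings S) : ∃ r₁ r₂, treeOf l = node (S.max' hS) r₁ r₂ := by
  obtain ⟨n, h⟩ := mem_orderings.1 hl
  obtain ⟨l₁, l₂, rfl⟩ := List.append_of_mem ((h _).2 (S.max'_mem hS))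
  rw [List.nodup_append, List.nodup_cons] at n
  obtain ⟨n₁, ⟨hm₂, n₂⟩, hd⟩ := n
  refine ⟨treeOf l₁, treeOf l₂, treeOf_append_cons (fun a ha => ?_) (fun a ha => ?_)⟩
  · exact lt_of_le_of_ne (S.le_max' a ((h a).1 (by simp [ha]))) (hd a ha _ (by simp))
  · refine lt_of_le_of_ne (S.le_max' a ((h a).1 (by simp [ha]))) ?_
    rintro rfl
    exact hm₂ ha

theorem childrenOrdered_iff {S A : Finset ℕ} (hS : S.Nonempty) (hA : A ⊆ S) {l₁ l₂ : List ℕ}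
    (h₁ : l₁ ∈ orderings A) (h₂ : l₂ ∈ orderings (S \ A)) :
    ChildrenOrdered (treeOf l₁) (treeOf l₂) ↔ S.max' hS ∈ A := by
  rcases A.eq_empty_or_nonempty with rfl | hA'
  · obtain rfl : l₁ = [] := by simpa using h₁
    rw [sdiff_empty] at h₂
    obtain ⟨r₁, r₂, h⟩ := exists_treeOf_eq_node hS h₂
    simp [h, ChildrenOrdered]
  · obtain ⟨r₁, r₂, h⟩ := exists_treeOf_eq_node hA' h₁
    rcases (S \ A).eq_empty_or_nonempty with hB | hB
    · rw [hB] at h₂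
      obtain rfl : l₂ = [] := by simpa using h₂
      rw [sdiff_eq_empty_iff_subset] at hB
      simpa [h, ChildrenOrdered] using hB (S.max'_mem hS)
    · obtain ⟨q₁, q₂, h'⟩ := exists_treeOf_eq_node hB h₂
      rw [h, h']
      change (S \ A).max' hB < A.max' hA' ↔ _
      have hBm := Finset.mem_sdiff.1 ((S \ A).max'_mem hB)
      constructor
      · intro hlt
        by_contra hmem
        have := (S \ A).le_max' _ (Finset.mem_sdiff.2 ⟨S.max'_mem hS, hmem⟩)
        exact absurd (S.le_max' _ (hA (A.max'_mem hA'))) (not_le.2 (this.trans_lt hlt))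
      · intro hmem
        refine lt_of_lt_of_le (lt_of_le_of_ne (S.le_max' _ hBm.1) ?_) (A.le_max' _ hmem)
        intro e
        exact hBm.2 (e ▸ hmem)

theorem two_mul_sum_powerset_ite_mem {S : Finset ℕ} {m : ℕ} (hm : m ∈ S)
    (F : Finset ℕ → Finset ℕ → ℕ) (hF : ∀ A B, F A B = F B A) :
    2 * ∑ A ∈ S.powerset, (if m ∈ A then F A (S \ A) else 0) =
      ∑ A ∈ S.powerset, F A (S \ A) := by
  have h : ∑ A ∈ S.powerset, (if m ∈ A then F A (S \ A) else 0) =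
      ∑ A ∈ S.powerset, (if m ∈ A then 0 else F A (S \ A)) := by
    refine Finset.sum_nbij' (fun A => S \ A) (fun A => S \ A) (by simp) (by simp) ?_ ?_ ?_
    · intro A hA
      simpa using hA
    · intro A hA
      simpa using hA
    · intro A hA
      have : S \ (S \ A) = A := by simpa using hA
      simp [this, hm, hF A]
  rw [two_mul]
  nth_rewrite 2 [h]
  rw [← Finset.sum_add_distrib]
  refine Finset.sum_congr rfl fun A _ => ?_
  split_ifs <;> simp

theorem two_mul_treeSum_treeWeight {S : Finset ℕ} (hS : S.Nonempty) {m : ℕ}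
    (hm : ∀ a ∈ S, a < m) :
    2 * treeSum treeWeight (insert m S) =
      ∑ A ∈ S.powerset, treeSum treeWeight A * treeSum treeWeight (S \ A) := by
  rw [← two_mul_sum_powerset_ite_mem (S.max'_mem hS)
    (fun A B => treeSum treeWeight A * treeSum treeWeight B) (fun A B => mul_comm _ _),
    treeSum_insert _ hm]
  congr 1
  refine Finset.sum_congr rfl fun A hA => ?_
  rw [Finset.mem_powerset] at hA
  classical
  have : ∀ l₁ ∈ orderings A, ∀ l₂ ∈ orderings (S \ A),
      treeWeight (node m (treeOf l₁) (treeOf l₂)) =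
        if S.max' hS ∈ A then treeWeight (treeOf l₁) * treeWeight (treeOf l₂) else 0 := by
    intro l₁ h₁ l₂ h₂
    simp only [treeWeight_node, childrenOrdered_iff hS hA h₁ h₂]
  rw [Finset.sum_congr rfl fun l₁ h₁ => Finset.sum_congr rfl fun l₂ h₂ => this l₁ h₁ l₂ h₂]
  split_ifs
  · simp only [treeSum, Finset.sum_mul_sum]
  · simp

theorem two_mul_treeSum_balWeight {S : Finset ℕ} (hS : S.Nonempty) {m : ℕ}
    (hm : ∀ a ∈ S, a < m) :
    2 * treeSum balWeight (insert m S) =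
      ∑ A ∈ S.powerset, (treeSum balWeight A * treeSum treeWeight (S \ A) +
        treeSum treeWeight A * treeSum balWeight (S \ A) +
        treeSum smallWeight A * treeSum smallWeight (S \ A)) := by
  rw [← two_mul_sum_powerset_ite_mem (S.max'_mem hS)
    (fun A B => treeSum balWeight A * treeSum treeWeight B +
        treeSum treeWeight A * treeSum balWeight B +
        treeSum smallWeight A * treeSum smallWeight B) (fun A B => by ring),
    treeSum_insert _ hm]
  congr 1
  refine Finset.sum_congr rfl fun A hA => ?_
  rw [Finset.mem_powerset] at hA
  classical
  have : ∀ l₁ ∈ orderings A, ∀ l₂ ∈ orderings (S \ A),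
      balWeight (node m (treeOf l₁) (treeOf l₂)) =
        if S.max' hS ∈ A then balWeight (treeOf l₁) * treeWeight (treeOf l₂) +
          treeWeight (treeOf l₁) * balWeight (treeOf l₂) +
          smallWeight (treeOf l₁) * smallWeight (treeOf l₂) else 0 := by
    intro l₁ h₁ l₂ h₂
    have hne : ¬(treeOf l₁ = nil ∧ treeOf l₂ = nil) := by
      rintro ⟨e₁, e₂⟩
      rcases A.eq_empty_or_nonempty with rfl | hA'
      · rw [sdiff_empty] at h₂
        obtain ⟨_, _, h⟩ := exists_treeOf_eq_node hS h₂
        simp [h] at e₂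
      · obtain ⟨_, _, h⟩ := exists_treeOf_eq_node hA' h₁
        simp [h] at e₁
    simp only [balWeight_node m hne, childrenOrdered_iff hS hA h₁ h₂]
  rw [Finset.sum_congr rfl fun l₁ h₁ => Finset.sum_congr rfl fun l₂ h₂ => this l₁ h₁ l₂ h₂]
  split_ifs
  · simp only [treeSum, Finset.sum_mul_sum, Finset.sum_add_distrib]
  · simp

theorem treeSum_empty (f : BT → ℕ) : treeSum f ∅ = f nil := by
  simp [treeSum]

theorem treeSum_singleton (f : BT → ℕ) (m : ℕ) : treeSum f {m} = f (node m nil nil) := by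
  have := treeSum_insert f (S := ∅) (m := m) (by simp)
  simpa using this

theorem treeSum_smallWeight (S : Finset ℕ) :
    treeSum smallWeight S = if S.card ≤ 1 then 1 else 0 := by
  rcases S.eq_empty_or_nonempty with rfl | hS
  · simp [treeSum_empty, smallWeight]
  · have hins : S = insert (S.max' hS) (S.erase (S.max' hS)) := by
      rw [Finset.insert_erase (S.max'_mem hS)]
    have hcard := Finset.card_erase_add_one (S.max'_mem hS)
    rcases (S.erase (S.max' hS)).eq_empty_or_nonempty with he | hT
    · rw [he, insert_empty_eq] at hins
      rw [hins, treeSum_singleton]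
      simp [smallWeight]
    · have := hT.card_pos
      rw [if_neg (by omega), hins,
        treeSum_insert _ (fun a ha => S.lt_max'_of_mem_erase_max' hS ha)]
      refine Finset.sum_eq_zero fun A hA => Finset.sum_eq_zero fun l₁ h₁ =>
        Finset.sum_eq_zero fun l₂ h₂ => ?_
      rcases A.eq_empty_or_nonempty with rfl | hA'
      · rw [sdiff_empty] at h₂
        obtain ⟨_, _, h⟩ := exists_treeOf_eq_node hT h₂
        rw [h]
        cases treeOf l₁ <;> rfl
      · obtain ⟨_, _, h⟩ := exists_treeOf_eq_node hA' h₁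
        rw [h]
        rfl

theorem b_one_eq_treeSum (n : ℕ) : b n 1 = treeSum balWeight (Finset.Icc 1 n) := by
  have hnd : (perms n).Nodup := List.nodup_permutations _ (List.nodup_range' 1)
  have hset : orderings (Finset.Icc 1 n) = (perms n).toFinset := by
    ext l
    rw [mem_orderings, List.mem_toFinset, perms, List.mem_permutations]
    constructor
    · rintro ⟨h₁, h₂⟩
      rw [List.perm_ext_iff_of_nodup h₁ (List.nodup_range' 1)]
      intro a
      rw [h₂, Finset.mem_Icc, List.mem_range'_1]
      omega
    · intro h
      refine ⟨h.nodup_iff.2 (List.nodup_range' 1), fun a => ?_⟩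
      rw [h.mem_iff, Finset.mem_Icc, List.mem_range'_1]
      omega
  rw [treeSum, hset, List.sum_toFinset _ hnd, b, npPerms]
  induction perms n with
  | nil => rfl
  | cons l L ih =>
    by_cases h : canonNP (treeOf l) = true <;> simp_all [balWeight]

end BalancedTrees

namespace BalancedTrees

open Complex

/-- The exponential generating function `sec z + tan z` of non-plane 1-2 trees. -/
noncomputable def treeGF (z : ℂ) : ℂ := cos z / (1 - sin z)

/-- The exponential generating function of balanced vertices of rank `1`. -/
noncomputable def balGF (z : ℂ) : ℂ :=
  1 / 6 * (((3 * z ^ 2 + 6 * z - 6) * cos z - (6 * z + 6) * sin z + z ^ 3 + 3 * z ^ 2 + 6) /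
    (1 - sin z))

theorem hasDerivAt_treeGF {z : ℂ} (hz : 1 - sin z ≠ 0) :
    HasDerivAt treeGF (1 / 2 * (treeGF z * treeGF z + 1)) z := by
  have h := (hasDerivAt_cos z).div ((hasDerivAt_sin z).const_sub 1) hz
  refine h.congr_deriv ?_
  rw [treeGF]
  field_simp
  linear_combination sin_sq_add_cos_sq z

theorem hasDerivAt_balGF {z : ℂ} (hz : 1 - sin z ≠ 0) :
    HasDerivAt balGF
      (balGF z * treeGF z + 1 / 2 * ((1 + z) * (1 + z) + -1)) z := by
  have hid := hasDerivAt_id z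
  have hnum := ((((((hid.pow 2).const_mul 3).add (hid.const_mul 6)).sub_const 6).mul
    (hasDerivAt_cos z)).sub (((hid.const_mul 6).add_const 6).mul (hasDerivAt_sin z))).add
    (hid.pow 3) |>.add ((hid.pow 2).const_mul 3) |>.add_const 6
  have h := (hnum.div ((hasDerivAt_sin z).const_sub 1) hz).const_mul (1 / 6)
  refine h.congr_deriv ?_
  simp only [balGF, treeGF, Pi.add_apply, Pi.sub_apply, Pi.mul_apply, Pi.pow_apply, id]
  field_simp
  push_cast
  ring

theorem contDiffAt_treeGF {n : WithTop ℕ∞} : ContDiffAt ℂ n treeGF 0 := by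
  unfold treeGF
  exact contDiff_cos.contDiffAt.div (contDiffAt_const.sub contDiff_sin.contDiffAt) (by simp)

theorem contDiffAt_balGF {n : WithTop ℕ∞} : ContDiffAt ℂ n balGF 0 := by
  unfold balGF
  have hc := contDiff_cos (n := n)
  have hs := contDiff_sin (n := n)
  refine contDiffAt_const.mul (ContDiffAt.div ?_ (contDiffAt_const.sub hs.contDiffAt) (by simp))
  apply ContDiff.contDiffAt
  fun_prop

theorem eventually_one_sub_sin_ne_zero : ∀ᶠ z : ℂ in nhds 0, 1 - sin z ≠ 0 := by
  have : ContinuousAt (fun z : ℂ => 1 - sin z) 0 := by fun_prop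
  exact this.eventually_ne (by simp)

theorem one_sub_sin_ne_zero {z : ℂ} (hz : ‖z‖ < Real.pi / 2) : 1 - sin z ≠ 0 := by
  intro h
  obtain ⟨k, rfl⟩ := sin_eq_one_iff.1 (sub_eq_zero.1 h).symm
  have e : (Real.pi / 2 + k * (2 * Real.pi) : ℂ) =
      ((Real.pi / 2 + k * (2 * Real.pi) : ℝ) : ℂ) := by push_cast; rfl
  rw [e, norm_real, Real.norm_eq_abs, abs_lt] at hz
  have hpi := Real.pi_pos
  have h1 : (k : ℝ) < 0 := by nlinarith
  have h2 : (-1 : ℝ) < k := by nlinarith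
  have h1' : k < 0 := by exact_mod_cast h1
  have h2' : -1 < k := by exact_mod_cast h2
  omega

theorem iteratedDeriv_succ_treeGF (n : ℕ) :
    2 * iteratedDeriv (n + 1) treeGF 0 =
      ∑ i ∈ Finset.range (n + 1),
        (n.choose i : ℂ) * iteratedDeriv i treeGF 0 * iteratedDeriv (n - i) treeGF 0 +
      if n = 0 then 1 else 0 := by
  have h : deriv treeGF =ᶠ[nhds 0] fun z => 1 / 2 * (treeGF z * treeGF z + 1) :=
    eventually_one_sub_sin_ne_zero.mono fun z hz => (hasDerivAt_treeGF hz).deriv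
  have hY := contDiffAt_treeGF (n := n)
  rw [iteratedDeriv_succ', h.iteratedDeriv_eq,
    iteratedDeriv_const_mul _ ((hY.mul hY).add contDiffAt_const),
    iteratedDeriv_fun_add (hY.mul hY) contDiffAt_const, iteratedDeriv_fun_mul hY hY,
    iteratedDeriv_const]
  ring

theorem iteratedDeriv_one_add (n : ℕ) :
    iteratedDeriv n (fun z : ℂ => 1 + z) 0 = if n ≤ 1 then 1 else 0 := by
  rcases n with _ | _ | n
  · simp
  · simp [iteratedDeriv_one]
  · have : deriv (fun z : ℂ => 1 + z) = fun _ => 1 := by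
      ext z
      simp
    rw [iteratedDeriv_succ', this, iteratedDeriv_const]
    simp

theorem iteratedDeriv_succ_balGF (n : ℕ) :
    2 * iteratedDeriv (n + 1) balGF 0 =
      2 * ∑ i ∈ Finset.range (n + 1),
        (n.choose i : ℂ) * iteratedDeriv i balGF 0 * iteratedDeriv (n - i) treeGF 0 +
      ∑ i ∈ Finset.range (n + 1),
        (n.choose i : ℂ) * (if i ≤ 1 then 1 else 0) * (if n - i ≤ 1 then 1 else 0) -
      if n = 0 then 1 else 0 := by
  have h : deriv balGF =ᶠ[nhds 0] fun z =>
      balGF z * treeGF z + 1 / 2 * ((1 + z) * (1 + z) + -1) :=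
    eventually_one_sub_sin_ne_zero.mono fun z hz => (hasDerivAt_balGF hz).deriv
  have hY := contDiffAt_treeGF (n := n)
  have hB := contDiffAt_balGF (n := n)
  have hK : ContDiffAt ℂ n (fun z : ℂ => 1 + z) 0 := by fun_prop
  have hKK := (hK.mul hK).add (contDiffAt_const (c := -1))
  rw [iteratedDeriv_succ', h.iteratedDeriv_eq,
    iteratedDeriv_fun_add (hB.mul hY) (contDiffAt_const.mul hKK),
    iteratedDeriv_const_mul _ hKK,
    iteratedDeriv_fun_add (hK.mul hK) contDiffAt_const, iteratedDeriv_fun_mul hB hY,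
    iteratedDeriv_fun_mul hK hK, iteratedDeriv_const]
  simp only [iteratedDeriv_one_add]
  split_ifs <;> ring

theorem hasSum_balGF {z : ℂ} (hz : ‖z‖ < Real.pi / 2) :
    HasSum (fun n : ℕ => ((n.factorial : ℂ))⁻¹ • (z - 0) ^ n • iteratedDeriv n balGF 0)
      (balGF z) := by
  refine hasSum_taylorSeries_on_ball (r := Real.pi / 2) (fun w hw => ?_) (by simpa using hz)
  rw [mem_ball_zero_iff] at hw
  exact (hasDerivAt_balGF (one_sub_sin_ne_zero hw)).differentiableAt.differentiableWithinAt

end BalancedTrees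

namespace BalancedTrees

open BT Finset

theorem sum_powerset_card_sdiff_card (f : ℕ → ℕ → ℂ) (S : Finset ℕ) :
    ∑ A ∈ S.powerset, f A.card (S \ A).card =
      ∑ i ∈ range (S.card + 1), (S.card.choose i : ℂ) * f i (S.card - i) := by
  rw [← Finset.sum_congr rfl fun A hA => by
    rw [Finset.card_sdiff_of_subset (Finset.mem_powerset.1 hA)],
    Finset.sum_powerset_apply_card (fun i => f i (S.card - i))]
  simp only [nsmul_eq_mul]

theorem exists_eq_insert_of_card_eq_succ {S : Finset ℕ} {n : ℕ} (h : S.card = n + 1) :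
    ∃ m T, (∀ a ∈ T, a < m) ∧ T.card = n ∧ S = insert m T := by
  have hS : S.Nonempty := Finset.card_pos.1 (by omega)
  refine ⟨S.max' hS, S.erase (S.max' hS), fun a ha => S.lt_max'_of_mem_erase_max' hS ha, ?_, ?_⟩
  · rw [Finset.card_erase_of_mem (S.max'_mem hS), h]
    rfl
  · rw [Finset.insert_erase (S.max'_mem hS)]

theorem treeSum_treeWeight_eq (n : ℕ) :
    ∀ S : Finset ℕ, S.card = n → (treeSum treeWeight S : ℂ) = iteratedDeriv n treeGF 0 := by
  induction n using Nat.strong_induction_on with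
  | _ n ih =>
    intro S hS
    rcases n with _ | n
    · rw [Finset.card_eq_zero] at hS
      simp [hS, treeSum_empty, treeWeight, canonNP, treeGF]
    · obtain ⟨m, T, hm, rfl, rfl⟩ := exists_eq_insert_of_card_eq_succ hS
      apply mul_left_cancel₀ (two_ne_zero (α := ℂ))
      rw [iteratedDeriv_succ_treeGF]
      rcases T.eq_empty_or_nonempty with rfl | hT
      · simp [treeSum_singleton, treeWeight, canonNP, treeGF]
        norm_num
      · have h := two_mul_treeSum_treeWeight hT hm
        have h' := congrArg (Nat.cast (R := ℂ)) h
        push_cast at h'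
        have hc : T.card ≠ 0 := hT.card_pos.ne'
        simp_rw [if_neg hc, add_zero, h', mul_assoc]
        rw [← sum_powerset_card_sdiff_card
          (fun i j => iteratedDeriv i treeGF 0 * iteratedDeriv j treeGF 0)]
        refine Finset.sum_congr rfl fun A hA => ?_
        rw [Finset.mem_powerset] at hA
        rw [ih A.card (Nat.lt_succ_of_le (Finset.card_le_card hA)) A rfl,
          ih (T \ A).card (Nat.lt_succ_of_le (Finset.card_le_card sdiff_subset)) _ rfl]

theorem sum_powerset_mul_comm (S : Finset ℕ) (f g : Finset ℕ → ℂ) :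
    ∑ A ∈ S.powerset, f A * g (S \ A) = ∑ A ∈ S.powerset, g A * f (S \ A) := by
  refine Finset.sum_nbij' (fun A => S \ A) (fun A => S \ A) (by simp) (by simp) ?_ ?_ ?_
  · intro A hA
    simpa using hA
  · intro A hA
    simpa using hA
  · intro A hA
    have : S \ (S \ A) = A := by simpa using hA
    rw [this, mul_comm]

theorem treeSum_balWeight_eq (n : ℕ) :
    ∀ S : Finset ℕ, S.card = n → (treeSum balWeight S : ℂ) = iteratedDeriv n balGF 0 := by
  induction n using Nat.strong_induction_on with
  | _ n ih =>
    intro S hS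
    rcases n with _ | n
    · rw [Finset.card_eq_zero] at hS
      simp [hS, treeSum_empty, balWeight, countBal, balGF]
    · obtain ⟨m, T, hm, rfl, rfl⟩ := exists_eq_insert_of_card_eq_succ hS
      apply mul_left_cancel₀ (two_ne_zero (α := ℂ))
      rw [iteratedDeriv_succ_balGF]
      rcases T.eq_empty_or_nonempty with rfl | hT
      · simp [treeSum_singleton, balWeight, countBal, balRank, balGF]
      · have h := congrArg (Nat.cast (R := ℂ)) (two_mul_treeSum_balWeight hT hm)
        push_cast at h
        have hc : T.card ≠ 0 := hT.card_pos.ne'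
        rw [if_neg hc, sub_zero, h, Finset.sum_add_distrib, Finset.sum_add_distrib,
          sum_powerset_mul_comm T (fun A => (treeSum treeWeight A : ℂ))
            (fun A => (treeSum balWeight A : ℂ)), ← two_mul]
        simp_rw [mul_assoc]
        rw [← sum_powerset_card_sdiff_card
          (fun i j => iteratedDeriv i balGF 0 * iteratedDeriv j treeGF 0),
          ← sum_powerset_card_sdiff_card
          (fun i j => (if i ≤ 1 then 1 else 0) * (if j ≤ 1 then 1 else 0))]
        congr 2
        · refine Finset.sum_congr rfl fun A hA => ?_
          rw [Finset.mem_powerset] at hA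
          rw [ih A.card (Nat.lt_succ_of_le (Finset.card_le_card hA)) A rfl,
            treeSum_treeWeight_eq _ (T \ A) rfl]
        · ext A
          simp [treeSum_smallWeight]

theorem b_one_eq_iteratedDeriv (n : ℕ) : (b n 1 : ℂ) = iteratedDeriv n balGF 0 := by
  rw [b_one_eq_treeSum, treeSum_balWeight_eq n _ (by simp)]

end BalancedTrees

open BalancedTrees

/-- For every real `x` with `|x| < π/2`, the series `∑_{n≥1} b(n,1) xⁿ/n!`
converges with sum
`(1/6) * ((3x² + 6x - 6) cos x - (6x + 6) sin x + x³ + 3x² + 6)/(1 - sin x)`. -/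
theorem statement12 (x : ℝ) (hx : |x| < Real.pi / 2) :
    HasSum
      (fun n : ℕ =>
        (b (n + 1) 1 : ℝ) * x ^ (n + 1) / (Nat.factorial (n + 1) : ℝ))
      (1 / 6 *
        (((3 * x ^ 2 + 6 * x - 6) * Real.cos x - (6 * x + 6) * Real.sin x +
            x ^ 3 + 3 * x ^ 2 + 6) /
          (1 - Real.sin x))) := by
  rw [← Complex.hasSum_ofReal]
  have h := hasSum_balGF (z := x) (by simpa using hx)
  rw [← hasSum_nat_add_iff' 1] at h
  convert h using 2 with n
  · rfl
  · rw [← b_one_eq_iteratedDeriv]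
    push_cast
    rw [sub_zero, smul_eq_mul, smul_eq_mul]
    ring
  · simp [balGF]
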